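/- Let F : A → B be a full, faithful, and exact functor between abelian categories that lifts subobjects, and let H and H' be monoform objects of A. Then H and H' are atom equivalent in A if and only if FH and FH' are atom equivalent in B. Consequently the map ASpec F : ASpec A → ASpec B, ⟨H⟩ ↦ ⟨FH⟩, is well defined and injective. -/

import Mathlib

/-!
Basic notions from Kanda's theory of atoms in abelian categories.
-/

open CategoryTheory CategoryTheory.Limits

namespace AtomSpectrum

variable {C : Type*} [Category C] [Abelian C]

/-- An object `H` of an abelian category is *monoform* if `H ≠ 0` and for every non-zero
subobject `N ↣ H` there is no common non-zero subobject of `H` and `H/N`; that is, whenever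
there are monomorphisms `H ↢ X ↣ H/N`, then `X = 0`. -/
def Monoform (H : C) : Prop :=
  ¬ IsZero H ∧
    ∀ (N : Subobject H), ¬ IsZero (N : C) →
      ∀ (X : C) (f : X ⟶ H) (g : X ⟶ cokernel N.arrow), Mono f → Mono g → IsZero X

/-- Two objects are *atom equivalent* if they have a common non-zero subobject. -/
def AtomEquiv (H H' : C) : Prop :=
  ∃ (M : C) (f : M ⟶ H) (g : M ⟶ H'), Mono f ∧ Mono g ∧ ¬ IsZero M

variable (C) in
/-- The *atom spectrum* of an abelian category: atom-equivalence classes of monoform objects. -/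
def ASpec : Type _ :=
  Quot (fun H H' : {H : C // Monoform H} => AtomEquiv H.1 H'.1)

/-- The atom `⟨H⟩` determined by a monoform object `H`. -/
def atom (H : C) (h : Monoform H) : ASpec C := Quot.mk _ ⟨H, h⟩

/-- The *atom support* of an object `M`: all atoms `⟨H⟩` where `H` is a monoform subquotient
`L/L'` of `M` (for subobjects `L' ⊆ L ⊆ M`). -/
def ASupp (M : C) : Set (ASpec C) :=
  {α | ∃ (H : C) (h : Monoform H), atom H h = α ∧
    ∃ (L : Subobject M) (L' : Subobject (L : C)), Nonempty (H ≅ cokernel L'.arrow)}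

/-- The localization topology on the atom spectrum: a set `Φ` is open iff for every
`⟨H⟩ ∈ Φ` there is some `H'` atom equivalent to `H` with `ASupp H' ⊆ Φ`. -/
instance : TopologicalSpace (ASpec C) :=
  TopologicalSpace.generateFrom
    {Φ | ∀ (H : C) (h : Monoform H), atom H h ∈ Φ →
      ∃ (H' : C) (_ : Monoform H'), AtomEquiv H' H ∧ ASupp H' ⊆ Φ}

end AtomSpectrum

namespace CategoryTheory.Functor

open CategoryTheory

variable {A : Type*} {B : Type*} [Category A] [Category B]

/-- A functor `F : A ⥤ B` *lifts subobjects* if every monomorphism `ι : Y ↣ F.obj X` is,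
up to isomorphism, of the form `F.map ι'` for a monomorphism `ι' : X' ↣ X`. -/
def LiftsSubobjects (F : A ⥤ B) : Prop :=
  ∀ (X : A) (Y : B) (ι : Y ⟶ F.obj X), Mono ι →
    ∃ (X' : A) (ι' : X' ⟶ X), Mono ι' ∧ ∃ e : Y ≅ F.obj X', e.hom ≫ F.map ι' = ι

/-- An additive functor between abelian categories is *exact* if it preserves finite limits
and finite colimits. -/
def IsExact (F : A ⥤ B) : Prop :=
  Nonempty (Limits.PreservesFiniteLimits F) ∧ Nonempty (Limits.PreservesFiniteColimits F)

end CategoryTheory.Functor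

open CategoryTheory CategoryTheory.Limits AtomSpectrum

namespace AtomSpectrum

variable {C : Type*} [Category C] [Abelian C]

lemma Monoform.isZero_of_mono {H : C} (h : Monoform H) {N X : C} (i : N ⟶ H) [Mono i]
    (hN : ¬ IsZero N) (f : X ⟶ H) (g : X ⟶ cokernel i) [Mono f] [Mono g] : IsZero X := by
  let e : cokernel i ≅ cokernel (Subobject.mk i).arrow :=
    cokernel.mapIso i (Subobject.mk i).arrow (Subobject.underlyingIso i).symm (Iso.refl H)
      (by simp)
  exact h.2 (Subobject.mk i) (fun hz => hN (hz.of_iso (Subobject.underlyingIso i).symm)) X f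
    (g ≫ e.hom) inferInstance inferInstance

/-- Monoform objects are uniform: two non-zero subobjects have non-zero intersection. -/
lemma Monoform.not_isZero_pullback {H : C} (h : Monoform H) {M N : C} (f : M ⟶ H) (g : N ⟶ H)
    [Mono f] [Mono g] (hM : ¬ IsZero M) (hN : ¬ IsZero N) : ¬ IsZero (pullback f g) := by
  intro hP
  have : Mono (f ≫ cokernel.π g) := by
    refine Preadditive.mono_of_cancel_zero _ fun {T} t ht => ?_
    rw [← Category.assoc] at ht
    have hl : Abelian.monoLift g (t ≫ f) ht ≫ g = t ≫ f := Abelian.monoLift_comp g (t ≫ f) ht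
    rw [← pullback.lift_fst t _ hl.symm, hP.eq_zero_of_tgt (pullback.lift t _ hl.symm),
      zero_comp]
  exact hM (h.isZero_of_mono g hN f (f ≫ cokernel.π g))

lemma AtomEquiv.symm {D : Type*} [Category D] {H H' : D} (h : AtomEquiv H H') : AtomEquiv H' H := by
  obtain ⟨M, f, g, hf, hg, hM⟩ := h
  exact ⟨M, g, f, hg, hf, hM⟩

lemma AtomEquiv.trans {H H' H'' : C} (h' : Monoform H') (h₁ : AtomEquiv H H')
    (h₂ : AtomEquiv H' H'') : AtomEquiv H H'' := by
  obtain ⟨M, f, g, hf, hg, hM⟩ := h₁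
  obtain ⟨N, k, l, hk, hl, hN⟩ := h₂
  exact ⟨pullback g k, pullback.fst g k ≫ f, pullback.snd g k ≫ l, inferInstance, inferInstance,
    h'.not_isZero_pullback g k hM hN⟩

lemma Monoform.atomEquiv_refl {H : C} (h : Monoform H) : AtomEquiv H H :=
  ⟨H, 𝟙 H, 𝟙 H, inferInstance, inferInstance, h.1⟩

lemma atom_eq_iff {H H' : C} (h : Monoform H) (h' : Monoform H') :
    atom H h = atom H' h' ↔ AtomEquiv H H' := by
  refine ⟨fun he => ?_, fun he => Quot.sound he⟩
  have hequiv : Equivalence (fun H H' : {H : C // Monoform H} => AtomEquiv H.1 H'.1) :=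
    ⟨fun H => H.2.atomEquiv_refl, fun e => e.symm, fun {_ y _} e e' => e.trans y.2 e'⟩
  exact hequiv.eqvGen_iff.1 (Quot.eqvGen_exact he)

variable {A B : Type*} [Category A] [Category B] [Abelian A] [Abelian B]

lemma isZero_obj_iff (F : A ⥤ B) [F.Full] [F.Faithful] (X : A) : IsZero (F.obj X) ↔ IsZero X := by
  rw [IsZero.iff_id_eq_zero, IsZero.iff_id_eq_zero, ← F.map_id, F.map_eq_zero_iff]

lemma Monoform.map {F : A ⥤ B} [F.Full] [F.Faithful] [PreservesFiniteColimits F]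
    (hlift : F.LiftsSubobjects) {H : A} (h : Monoform H) : Monoform (F.obj H) := by
  refine ⟨fun hz => h.1 ((isZero_obj_iff F H).1 hz), fun N hN X f g hf hg => ?_⟩
  obtain ⟨N', i, hi, e, he⟩ := hlift H _ N.arrow inferInstance
  obtain ⟨X', f', hf', e', -⟩ := hlift H X f hf
  let c : cokernel N.arrow ≅ F.obj (cokernel i) :=
    cokernel.mapIso N.arrow (F.map i) e (Iso.refl _) (by simp [he]) ≪≫
      (PreservesCokernel.iso F i).symm
  have : Mono (F.preimage (e'.inv ≫ g ≫ c.hom)) :=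
    F.mono_of_mono_map (by rw [F.map_preimage]; infer_instance)
  have hN' : ¬ IsZero N' := fun hz => hN (((isZero_obj_iff F N').2 hz).of_iso e)
  exact ((isZero_obj_iff F X').2
    (h.isZero_of_mono i hN' f' (F.preimage (e'.inv ≫ g ≫ c.hom)))).of_iso e'

lemma atomEquiv_obj_iff {F : A ⥤ B} [F.Full] [F.Faithful] [PreservesFiniteLimits F]
    (hlift : F.LiftsSubobjects) (H H' : A) :
    AtomEquiv (F.obj H) (F.obj H') ↔ AtomEquiv H H' := by
  constructor
  · rintro ⟨M, f, g, hf, hg, hM⟩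
    obtain ⟨M', f', hf', e, -⟩ := hlift H M f hf
    refine ⟨M', f', F.preimage (e.inv ≫ g), hf', ?_, fun hz =>
      hM (((isZero_obj_iff F M').2 hz).of_iso e)⟩
    exact F.mono_of_mono_map (by rw [F.map_preimage]; infer_instance)
  · rintro ⟨M, f, g, hf, hg, hM⟩
    exact ⟨F.obj M, F.map f, F.map g, inferInstance, inferInstance,
      fun hz => hM ((isZero_obj_iff F M).1 hz)⟩

end AtomSpectrum

/-- Let `F : A ⥤ B` be a full, faithful and exact functor between abelian
categories that lifts subobjects.  Monoform objects `H, H'` of `A` are atom equivalent iff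
`F.obj H` and `F.obj H'` are atom equivalent; consequently the induced map
`ASpec F : ASpec A → ASpec B`, `⟨H⟩ ↦ ⟨F.obj H⟩`, is well defined and injective. -/
theorem atomEquiv_iff_and_aspecMap_injective
    {A B : Type*} [Category A] [Category B] [Abelian A] [Abelian B]
    (F : A ⥤ B) [F.Full] [F.Faithful] (hex : F.IsExact) (hlift : F.LiftsSubobjects) :
    (∀ (H H' : A), Monoform H → Monoform H' →
        (AtomEquiv H H' ↔ AtomEquiv (F.obj H) (F.obj H'))) ∧
    ∃ f : ASpec A → ASpec B,
      (∀ (H : A) (h : Monoform H), ∃ h' : Monoform (F.obj H), f (atom H h) = atom (F.obj H) h') ∧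
      Function.Injective f := by
  obtain ⟨⟨_⟩, ⟨_⟩⟩ := hex
  refine ⟨fun H H' _ _ => (atomEquiv_obj_iff hlift H H').symm,
    Quot.lift (fun H => atom (F.obj H.1) (H.2.map hlift)) ?_,
    fun H h => ⟨h.map hlift, rfl⟩, ?_⟩
  · intro H H' e
    exact (atom_eq_iff _ _).2 ((atomEquiv_obj_iff hlift _ _).2 e)
  · rintro ⟨H, h⟩ ⟨H', h'⟩ e
    exact (atom_eq_iff h h').2 ((atomEquiv_obj_iff hlift _ _).1 ((atom_eq_iff _ _).1 e))
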